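/- Let n ≥ 2, let ν ∈ ℂ^n be regular and let P ⊆ {1,…,n−1}. Then b^P_{(0,…,0)}(ν) = ∏_{i∈P̃} Γ(ν_i−ν_{i+1}+1) / ( Γ(ν_i−ν_n+1) Γ(−ν_{i+1}+ν_n+1) ); in particular b^P_{(0,…,0)}(ν) = 1 when P̃ = ∅. -/

import Mathlib

noncomputable section

open MeasureTheory Finset

namespace SO

/-- Extend a `Fin n`-indexed real tuple to a `1`-based function on `ℕ` (default value `0`). -/
def extR (n : ℕ) (t : Fin n → ℝ) : ℕ → ℝ :=
  fun i => if h : 1 ≤ i ∧ i ≤ n then t ⟨i - 1, by omega⟩ else 0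

/-- Extend a `Fin n`-indexed tuple of naturals to a `1`-based function on `ℕ` (default `0`). -/
def extN (n : ℕ) (t : Fin n → ℕ) : ℕ → ℕ :=
  fun i => if h : 1 ≤ i ∧ i ≤ n then t ⟨i - 1, by omega⟩ else 0

/-- The quadratic form `q_n(m, ν)`. -/
def qB (n : ℕ) (m : ℕ → ℕ) (ν : ℕ → ℂ) : ℂ :=
  (∑ i ∈ Finset.Icc 1 (n - 1), ((m i : ℂ)) ^ 2) + (1 / 2) * (m n : ℂ) ^ 2
    - (∑ i ∈ Finset.Icc 1 (n - 1), (m i : ℂ) * (m (i + 1) : ℂ))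
    + (∑ i ∈ Finset.Icc 1 (n - 1), (ν i - ν (i + 1)) * (m i : ℂ))
    + ν n * (m n : ℂ)

/-- Decrement the `i`-th coordinate by one. -/
def dec (m : ℕ → ℕ) (i : ℕ) : ℕ → ℕ := Function.update m i (m i - 1)

/-- Auxiliary (fuel-indexed) recursion computing the coefficients `c_{n,m}(ν)`. -/
def cAux (n : ℕ) (ν : ℕ → ℂ) : ℕ → (ℕ → ℕ) → ℂ
  | 0, _ => 1
  | d + 1, m =>
      ((∑ i ∈ Finset.Icc 1 (n - 1), if m i = 0 then 0 else cAux n ν d (dec m i))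
        + (1 / 2) * (if m n = 0 then 0 else cAux n ν d (dec m n))) / qB n m ν

/-- The coefficients `c_{n,m}(ν)`, determined by `c_{n,0} = 1` and the recurrence
`q_n(m,ν) c_{n,m}(ν) = ∑_{i=1}^{n-1} c_{n,m-e_i}(ν) + (1/2) c_{n,m-e_n}(ν)`. -/
def cB (n : ℕ) (ν : ℕ → ℂ) (m : ℕ → ℕ) : ℂ :=
  cAux n ν (∑ i ∈ Finset.Icc 1 n, m i) m

/-- Pochhammer symbol `(a)_k = Γ(a+k)/Γ(a)` for `k ∈ ℤ`. -/
def poch (a : ℂ) (k : ℤ) : ℂ := Complex.Gamma (a + k) / Complex.Gamma a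

/-- `z! ∈ ℂ` for `z ∈ ℤ`, with value `0` at negative integers (so that a factor `1/zfact z`
kills a summand containing the factorial of a negative integer). -/
def zfact (z : ℤ) : ℂ := if 0 ≤ z then (Nat.factorial z.toNat : ℂ) else 0

/-- `Γ_n(ν) = ∏_{1≤i<j≤n} Γ(-ν_i-ν_j)Γ(-ν_i+ν_j) ∏_{i=1}^n Γ(-2ν_i)`. -/
def GammaN (n : ℕ) (ν : ℕ → ℂ) : ℂ :=
  (∏ i ∈ Finset.Icc 1 n, ∏ j ∈ Finset.Icc (i + 1) n,
      Complex.Gamma (-ν i - ν j) * Complex.Gamma (-ν i + ν j)) *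
    ∏ i ∈ Finset.Icc 1 n, Complex.Gamma (-(2 * ν i))

/-- The Weyl group of type `B_n`: pairs of a permutation and a sign change. -/
abbrev SignedPerm (n : ℕ) := Equiv.Perm (Fin n) × (Fin n → Bool)

/-- Action of a signed permutation on `ν ∈ ℂ^n` (1-based indexing). -/
def wAct (n : ℕ) (w : SignedPerm n) (ν : ℕ → ℂ) : ℕ → ℂ :=
  fun i =>
    if h : 1 ≤ i ∧ i ≤ n then
      (if w.2 ⟨i - 1, by omega⟩ then -1 else 1) * ν ((w.1 ⟨i - 1, by omega⟩ : Fin n).val + 1)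
    else ν i

/-- Regularity of `ν ∈ ℂ^n`. -/
def Regular (n : ℕ) (ν : ℕ → ℂ) : Prop :=
  (∀ w : SignedPerm n, ∀ m : ℕ → ℕ,
      0 < ∑ i ∈ Finset.Icc 1 n, m i → qB n m (wAct n w ν) ≠ 0) ∧
    ∀ w w' : SignedPerm n, w ≠ w' →
      ¬ ∀ i ∈ Finset.Icc 1 n, ∃ k : ℤ, wAct n w ν i - wAct n w' ν i = (k : ℂ)

/-- The fundamental Whittaker power series `M̃^n_ν(y)`. -/
def Mt (n : ℕ) (ν : ℕ → ℂ) (y : ℕ → ℝ) : ℂ :=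
  ∑' m : Fin n → ℕ,
    cB n ν (extN n m) *
      ∏ i ∈ Finset.Icc 1 n,
        ((Real.pi * y i : ℝ) : ℂ) ^ (2 * ((extN n m i : ℂ) + ∑ j ∈ Finset.Icc 1 i, ν j))

/-- The modified Bessel function `K_s(z)` (for `Re z > 0`). -/
def besselK (s z : ℂ) : ℂ :=
  (1 / 2) * ∫ t in Set.Ioi (0 : ℝ),
    Complex.exp (-(z / 2) * ((t : ℂ) + 1 / (t : ℂ))) * (t : ℂ) ^ s / (t : ℂ)

/-- The positive orthant in `(ℝ)^n`. -/
def posSet (n : ℕ) : Set (Fin n → ℝ) := {t | ∀ i, 0 < t i}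

/-- The integrand in the recursive definition of `W̃^N_ν(y)`; `W` stands for `W̃^{N-1}_ν̃`. -/
def WtKernel (N : ℕ) (ν : ℕ → ℂ) (y : ℕ → ℝ) (W : (ℕ → ℝ) → ℂ)
    (t : Fin N → ℝ) (u : Fin (N - 1) → ℝ) : ℂ :=
  ((∏ i ∈ Finset.Icc 1 N,
      Real.exp (-(Real.pi * y i) ^ 2 * extR N t i - 1 / extR N t i) : ℝ) : ℂ) *
    (∏ i ∈ Finset.Icc 1 N, ((Real.pi * y i : ℝ) : ℂ) ^ (2 * ν N)) *
    ((∏ i ∈ Finset.Icc 1 (N - 1),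
        Real.exp (-(Real.pi * y i) ^ 2 * (extR N t i / extR N t (i + 1)) * extR (N - 1) u i
          - 1 / extR (N - 1) u i) : ℝ) : ℂ) *
    ((extR N t 1 : ℝ) : ℂ) ^ (2 * ν N) *
    (∏ i ∈ Finset.Icc 1 (N - 1),
      ((extR N t (i + 1) * extR (N - 1) u i : ℝ) : ℂ) ^ (ν N)) *
    W (fun j => if j = N - 1 then y N * Real.sqrt (extR N t N / extR (N - 1) u (N - 1))
        else y (j + 1) * Real.sqrt (extR N t (j + 1) * extR (N - 1) u (j + 1) /
          (extR N t (j + 2) * extR (N - 1) u j))) *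
    (((∏ i ∈ Finset.Icc 1 (N - 1), extR (N - 1) u i)⁻¹ : ℝ) : ℂ) *
    (((∏ i ∈ Finset.Icc 1 N, extR N t i)⁻¹ : ℝ) : ℂ)

/-- The class one Whittaker function `W̃^n_ν(y)`, defined recursively. -/
def Wt : ℕ → (ℕ → ℂ) → (ℕ → ℝ) → ℂ
  | 0, _, _ => 0
  | 1, ν, y => 2 * besselK (2 * ν 1) (2 * Real.pi * y 1)
  | n + 2, ν, y =>
      ∫ t in posSet (n + 2), ∫ u in posSet (n + 1),
        WtKernel (n + 2) ν y (fun z => Wt (n + 1) ν z) t u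

/-- The auxiliary function `V_ν(x)`. -/
def Vnu (n : ℕ) (ν : ℕ → ℂ) (x : ℕ → ℝ) : ℂ :=
  ∫ u in posSet (n - 1),
    ((∏ i ∈ Finset.Icc 1 (n - 1),
        Real.exp (-(Real.pi * x i) ^ 2 * extR (n - 1) u i - 1 / extR (n - 1) u i) : ℝ) : ℂ) *
      (∏ i ∈ Finset.Icc 1 n, ((Real.pi * x i : ℝ) : ℂ) ^ (2 * ν n)) *
      (∏ i ∈ Finset.Icc 1 (n - 1), ((extR (n - 1) u i : ℝ) : ℂ) ^ (ν n)) *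
      Wt (n - 1) ν (fun j => if j = n - 1 then x n * Real.sqrt (1 / extR (n - 1) u (n - 1))
          else x (j + 1) * Real.sqrt (extR (n - 1) u (j + 1) / extR (n - 1) u j)) *
      (((∏ i ∈ Finset.Icc 1 (n - 1), extR (n - 1) u i)⁻¹ : ℝ) : ℂ)

/-- The coefficients `b_l(ν)` (zero unless all `l_i ≥ 0` and `l_{n-1} ≥ l_n`). -/
def bB (n : ℕ) (ν : ℕ → ℂ) (l : ℕ → ℤ) : ℂ :=
  if (∀ i ∈ Finset.Icc 1 n, 0 ≤ l i) ∧ l n ≤ l (n - 1) then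
    (-1 : ℂ) ^ (l n) *
      ∑' k : Fin (n - 2) → ℕ,
        cB (n - 1) ν (fun i => if i = n - 1 then (l n).toNat else extN (n - 2) k i) /
          ((∏ i ∈ Finset.Icc 1 (n - 2), zfact (l i - (extN (n - 2) k i : ℤ))) *
            zfact (l (n - 1) - l n) *
            ∏ i ∈ Finset.Icc 1 (n - 1),
              poch (ν i - ν n + 1) (l i - (extN (n - 2) k (i - 1) : ℤ)))
  else 0

/-- The coefficients `b^P_l(ν)` (zero unless all `l_i ≥ 0` and `l_{n-1} ≥ l_n`). -/
def bP (n : ℕ) (P : Finset ℕ) (ν : ℕ → ℂ) (l : ℕ → ℤ) : ℂ :=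
  if (∀ i ∈ Finset.Icc 1 n, 0 ≤ l i) ∧ l n ≤ l (n - 1) then
    (-1 : ℂ) ^ (l n) *
      ∑' k : Fin (n - 2) → ℕ,
        cB (n - 1) ν (fun i => if i = n - 1 then (l n).toNat else extN (n - 2) k i) /
          ((∏ i ∈ (Finset.Icc 1 (n - 2)).filter (· ∈ P),
              zfact (l i - (extN (n - 2) k i : ℤ)) *
                poch (ν i - ν n + 1) (l i - (extN (n - 2) k (i - 1) : ℤ))) *
            (∏ i ∈ (Finset.Icc 1 (n - 2)).filter (· ∉ P),
              zfact (l i - (extN (n - 2) k (i - 1) : ℤ)) *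
                poch (-ν i + ν n + 1) (l i - (extN (n - 2) k i : ℤ))) *
            (if n - 1 ∈ P then
                zfact (l (n - 1) - l n) *
                  poch (ν (n - 1) - ν n + 1) (l (n - 1) - (extN (n - 2) k (n - 2) : ℤ))
              else
                zfact (l (n - 1) - (extN (n - 2) k (n - 2) : ℤ)) *
                  poch (-ν (n - 1) + ν n + 1) (l (n - 1) - l n)))
  else 0

/-- `ν^{(p)} = (ν_1, …, ν_{p-1}, ν_n, ν_p, …, ν_{n-1})`. -/
def nuP (n p : ℕ) (ν : ℕ → ℂ) : ℕ → ℂ :=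
  fun i => if i < p then ν i else if i = p then ν n else ν (i - 1)

/-- `ν̄^{(q)} = (ν_1, …, ν_{q-1}, -ν_n, ν_q, …, ν_{n-1})`. -/
def nuBar (n q : ℕ) (ν : ℕ → ℂ) : ℕ → ℂ :=
  fun i => if i < q then ν i else if i = q then -ν n else ν (i - 1)

/-- `Γ^P(ν)`. -/
def GammaP (n : ℕ) (P : Finset ℕ) (ν : ℕ → ℂ) : ℂ :=
  GammaN (n - 1) ν *
    (∏ i ∈ (Finset.Icc 1 (n - 1)).filter (· ∈ P), Complex.Gamma (-ν i + ν n)) *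
    ∏ i ∈ (Finset.Icc 1 (n - 1)).filter (· ∉ P), Complex.Gamma (ν i - ν n)

/-- `Γ^p(ν) = Γ^P(ν)` with `P = {1, …, p-1}`. -/
def Gammap (n p : ℕ) (ν : ℕ → ℂ) : ℂ := GammaP n (Finset.Icc 1 (p - 1)) ν

/-- `b^p_l(ν) = b^P_l(ν)` with `P = {1, …, p-1}`. -/
def bp (n p : ℕ) (ν : ℕ → ℂ) (l : ℕ → ℤ) : ℂ := bP n (Finset.Icc 1 (p - 1)) ν l

/-- `Γ^{p,Q}(ν)`. -/
def GammaPQ (n p : ℕ) (Q : Finset ℕ) (ν : ℕ → ℂ) : ℂ :=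
  Gammap n p ν *
    (∏ i ∈ (Finset.Icc 1 n).filter (· ∈ Q), Complex.Gamma (-(nuP n p ν i) - ν n)) *
    ∏ i ∈ (Finset.Icc 1 n).filter (· ∉ Q), Complex.Gamma (nuP n p ν i + ν n)

/-- The coefficients `c^{p,Q}_m(ν)` (zero if some `m_i < 0`). -/
def cPQ (n p : ℕ) (Q : Finset ℕ) (ν : ℕ → ℂ) (m : ℕ → ℤ) : ℂ :=
  if ∀ i ∈ Finset.Icc 1 n, 0 ≤ m i then
    ∑' l : Fin n → ℕ,
      (-1 : ℂ) ^ ((extN n l n : ℤ)) * bp n p ν (fun i => (extN n l i : ℤ)) /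
        ((∏ i ∈ (Finset.Icc 1 n).filter (· ∈ Q),
            zfact (m i - (extN n l i : ℤ)) *
              poch (nuP n p ν i + ν n + 1) (m i - (extN n l (i - 1) : ℤ))) *
          ∏ i ∈ (Finset.Icc 1 n).filter (· ∉ Q),
            zfact (m i - (extN n l (i - 1) : ℤ)) *
              poch (-(nuP n p ν i) - ν n + 1) (m i - (extN n l i : ℤ)))
  else 0

/-- The power series `M̃^{p,Q}_ν(y)`. -/
def MPQ (n p : ℕ) (Q : Finset ℕ) (ν : ℕ → ℂ) (y : ℕ → ℝ) : ℂ :=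
  ∑' m : Fin n → ℕ,
    cPQ n p Q ν (fun i => (extN n m i : ℤ)) *
      (∏ i ∈ (Finset.Icc 1 n).filter (· ∈ Q),
        ((Real.pi * y i : ℝ) : ℂ) ^
          (2 * ((extN n m i : ℂ) + ∑ j ∈ Finset.Icc 1 i, nuP n p ν j))) *
      ∏ i ∈ (Finset.Icc 1 n).filter (· ∉ Q),
        ((Real.pi * y i : ℝ) : ℂ) ^
          (2 * ((extN n m i : ℂ) + ∑ j ∈ Finset.Icc 1 (i - 1), nuP n p ν j - ν n))

/-- The Mellin-transform integrand. -/
def Tintegrand (n : ℕ) (ν : ℕ → ℂ) (s : ℕ → ℂ) (y : Fin n → ℝ) : ℂ :=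
  Wt n ν (extR n y) *
    (∏ i ∈ Finset.Icc 1 n, ((Real.pi * extR n y i : ℝ) : ℂ) ^ (2 * s i)) *
    (((∏ i ∈ Finset.Icc 1 n, extR n y i)⁻¹ : ℝ) : ℂ)

/-- The multiple Mellin transform `T^n_ν(s)` of the class one Whittaker function. -/
def Tn (n : ℕ) (ν : ℕ → ℂ) (s : ℕ → ℂ) : ℂ := ∫ y in posSet n, Tintegrand n ν s y


/-- `a` is not an integer. -/
def NotInt (a : ℂ) : Prop := ∀ k : ℤ, a ≠ (k : ℂ)

theorem NotInt.add_ne {a : ℂ} (h : NotInt a) (k : ℤ) : a + k ≠ 0 := by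
  intro h0
  apply h (-k)
  push_cast
  linear_combination h0

/-- The Gauss hypergeometric term with `c = a + b + 1`. -/
def gT (a b : ℂ) (k : ℕ) : ℂ :=
  ∏ j ∈ Finset.range k, ((a + j) * (b + j) / ((j + 1) * (a + b + 1 + j)))

/-- Its partial sums. -/
def gS (a b : ℂ) (k : ℕ) : ℂ :=
  ∏ j ∈ Finset.range k, ((a + 1 + j) * (b + 1 + j) / ((j + 1) * (a + b + 1 + j)))

theorem gT_succ {a b : ℂ} (hab : NotInt (a + b)) (N : ℕ) :
    gT a b (N + 1) = gS a b N * (a * b / ((N + 1) * (a + b + 1 + N))) := by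
  induction N with
  | zero => simp [gT, gS]
  | succ N ih =>
    have h1 : ((N : ℂ) + 1) ≠ 0 := by exact_mod_cast Nat.succ_ne_zero N
    have h1' : ((N : ℂ) + 1 + 1) ≠ 0 := by exact_mod_cast Nat.succ_ne_zero (N + 1)
    have h2 : (a + b + 1 + N) ≠ 0 := by
      have := hab.add_ne (1 + N); push_cast at this; rwa [← add_assoc] at this
    have h3 : (a + b + 1 + (N + 1)) ≠ 0 := by
      have := hab.add_ne (1 + (N + 1)); push_cast at this; rwa [← add_assoc] at this
    have e1 : gT a b (N + 1 + 1) = gT a b (N + 1) *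
        ((a + (N + 1)) * (b + (N + 1)) / ((N + 1 + 1) * (a + b + 1 + (N + 1)))) := by
      rw [gT, Finset.prod_range_succ, ← gT]; push_cast; rfl
    have e2 : gS a b (N + 1) = gS a b N *
        ((a + 1 + N) * (b + 1 + N) / ((N + 1) * (a + b + 1 + N))) := by
      rw [gS, Finset.prod_range_succ, ← gS]
    rw [e1, e2, ih]
    push_cast
    field_simp
    ring

theorem gT_sum {a b : ℂ} (hab : NotInt (a + b)) (N : ℕ) :
    ∑ k ∈ Finset.range (N + 1), gT a b k = gS a b N := by
  induction N with
  | zero => simp [gT, gS]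
  | succ N ih =>
    have h1 : ((N : ℂ) + 1) ≠ 0 := by exact_mod_cast Nat.succ_ne_zero N
    have h2 : (a + b + 1 + N) ≠ 0 := by
      have := hab.add_ne (1 + N); push_cast at this; rwa [← add_assoc] at this
    have e2 : gS a b (N + 1) = gS a b N *
        ((a + 1 + N) * (b + 1 + N) / ((N + 1) * (a + b + 1 + N))) := by
      rw [gS, Finset.prod_range_succ, ← gS]
    rw [Finset.sum_range_succ, ih, gT_succ hab, e2]
    field_simp
    ring

open Filter Topology in
theorem gS_tendsto {a b : ℂ} (ha : NotInt a) (hb : NotInt b) (hab : NotInt (a + b)) :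
    Tendsto (gS a b) atTop (𝓝 (Complex.Gamma (a + b + 1) /
      (Complex.Gamma (a + 1) * Complex.Gamma (b + 1)))) := by
  rw [← tendsto_add_atTop_iff_nat 1]
  have gne : ∀ {x : ℂ}, NotInt x → Complex.Gamma (x + 1) ≠ 0 := by
    intro x hx
    apply Complex.Gamma_ne_zero
    intro m h
    have := hx.add_ne (1 + m)
    push_cast at this
    apply this
    linear_combination h
  have key : Tendsto (fun n : ℕ => ((n : ℂ) / ((n : ℂ) + 1)) * (Complex.GammaSeq (a + b + 1) n /
      (Complex.GammaSeq (a + 1) n * Complex.GammaSeq (b + 1) n))) atTop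
      (𝓝 (1 * (Complex.Gamma (a + b + 1) /
      (Complex.Gamma (a + 1) * Complex.Gamma (b + 1))))) := by
    apply Tendsto.mul
    · exact tendsto_natCast_div_add_atTop (1 : ℂ)
    · exact (Complex.GammaSeq_tendsto_Gamma _).div ((Complex.GammaSeq_tendsto_Gamma _).mul
        (Complex.GammaSeq_tendsto_Gamma _)) (mul_ne_zero (gne ha) (gne hb))
  rw [one_mul] at key
  refine key.congr' ?_
  filter_upwards [eventually_ne_atTop 0] with n hn
  have hn' : (n : ℂ) ≠ 0 := by exact_mod_cast hn
  have pne : ∀ {x : ℂ}, NotInt x → ∏ j ∈ Finset.range (n + 1), (x + 1 + (j : ℂ)) ≠ 0 := by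
    intro x hx
    rw [Finset.prod_ne_zero_iff]
    intro j _
    have := hx.add_ne (1 + j)
    push_cast at this
    rwa [← add_assoc] at this
  have hA := pne ha
  have hB := pne hb
  have hC := pne hab
  have hf : ∏ j ∈ Finset.range (n + 1), ((j : ℂ) + 1) = ((n + 1) * n.factorial : ℂ) := by
    have := Finset.prod_range_add_one_eq_factorial (n + 1)
    rw [Nat.factorial_succ] at this
    exact_mod_cast this
  have hfne : (n.factorial : ℂ) ≠ 0 := by exact_mod_cast n.factorial_ne_zero
  have hn1 : ((n : ℂ) + 1) ≠ 0 := by exact_mod_cast Nat.succ_ne_zero n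
  have p1 : (n : ℂ) ^ (a + b + 1) = (n : ℂ) ^ a * (n : ℂ) ^ b * n := by
    rw [Complex.cpow_add _ _ hn', Complex.cpow_add _ _ hn', Complex.cpow_one]
  have p2 : (n : ℂ) ^ (a + 1) = (n : ℂ) ^ a * n := by
    rw [Complex.cpow_add _ _ hn', Complex.cpow_one]
  have p3 : (n : ℂ) ^ (b + 1) = (n : ℂ) ^ b * n := by
    rw [Complex.cpow_add _ _ hn', Complex.cpow_one]
  have q1 : (n : ℂ) ^ a ≠ 0 := by simp [Complex.cpow_eq_zero_iff, hn]
  have q2 : (n : ℂ) ^ b ≠ 0 := by simp [Complex.cpow_eq_zero_iff, hn]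
  rw [gS, Finset.prod_div_distrib, Finset.prod_mul_distrib, Finset.prod_mul_distrib, hf]
  simp only [Complex.GammaSeq, p1, p2, p3]
  field_simp

open Filter Topology in
theorem gT_summable {a b : ℂ} (ha : NotInt a) (hb : NotInt b) (hab : NotInt (a + b)) :
    Summable (fun k => ‖gT a b k‖) := by
  have hS := (gS_tendsto ha hb hab).norm.isBigO_one ℝ
  rw [← summable_nat_add_iff 2]
  have h1 : (fun n : ℕ => ‖gT a b (n + 2)‖) =O[atTop] (fun n : ℕ => 1 / ((n + 1 : ℕ) : ℝ) ^ 2) := by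
    have e : (fun n : ℕ => ‖gT a b (n + 2)‖) =
        fun n : ℕ => ‖gS a b (n + 1)‖ * ‖a * b / (((n + 1 : ℕ) + 1 : ℂ) * (a + b + 1 + (n + 1 : ℕ)))‖ := by
      funext n
      rw [show n + 2 = (n + 1) + 1 from rfl, gT_succ hab, norm_mul]
    rw [e]
    have hS' : (fun n : ℕ => ‖gS a b (n + 1)‖) =O[atTop] (fun _ => (1 : ℝ)) :=
      hS.comp_tendsto (tendsto_add_atTop_nat 1)
    have h2 : (fun n : ℕ => ‖a * b / (((n + 1 : ℕ) + 1 : ℂ) * (a + b + 1 + (n + 1 : ℕ)))‖)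
        =O[atTop] (fun n : ℕ => 1 / ((n + 1 : ℕ) : ℝ) ^ 2) := by
      have h3 : (fun n : ℕ => a * b / (((n : ℕ) + 1 : ℂ) * (a + b + 1 + (n : ℕ))))
        =O[atTop] (fun n : ℕ => 1 / ((n : ℕ) : ℝ) ^ 2) := by
        have t1 := (((tendsto_natCast_div_add_atTop (1 : ℂ)).mul
          (tendsto_natCast_div_add_atTop (a + b + 1))).const_mul (a * b)).isBigO_one ℝ
        have t2 : (fun n : ℕ => 1 / (n : ℂ) ^ 2) =O[atTop] (fun n : ℕ => 1 / ((n : ℕ) : ℝ) ^ 2) := by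
          apply Asymptotics.isBigO_of_le
          intro n
          simp
        have t3 := t1.mul t2
        simp only [one_mul] at t3
        refine t3.congr' ?_ Filter.EventuallyEq.rfl
        filter_upwards [eventually_ne_atTop 0] with n hn
        have hn' : (n : ℂ) ≠ 0 := by exact_mod_cast hn
        have hn1 : ((n : ℂ) + 1) ≠ 0 := by exact_mod_cast Nat.succ_ne_zero n
        have h2 : (a + b + 1 + n) ≠ 0 := by
          have := hab.add_ne (1 + n); push_cast at this; rwa [← add_assoc] at this
        have h2' : ((n : ℂ) + (a + b + 1)) ≠ 0 := by rwa [add_comm]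
        rw [add_comm (a + b + 1) (n : ℂ)]
        field_simp
      exact (h3.comp_tendsto (tendsto_add_atTop_nat 1)).norm_left
    simpa using hS'.mul h2
  refine summable_of_isBigO_nat ?_ h1
  exact (summable_nat_add_iff 1).2 (Real.summable_one_div_nat_pow.2 one_lt_two)

theorem gT_tsum {a b : ℂ} (ha : NotInt a) (hb : NotInt b) (hab : NotInt (a + b)) :
    ∑' k, gT a b k = Complex.Gamma (a + b + 1) /
      (Complex.Gamma (a + 1) * Complex.Gamma (b + 1)) := by
  have h := (gT_summable ha hb hab).of_norm.hasSum.tendsto_sum_nat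
  refine tendsto_nhds_unique ((Filter.tendsto_add_atTop_iff_nat 1).2 h) ?_
  simp_rw [gT_sum hab]
  exact gS_tendsto ha hb hab

theorem tsum_pi_prod : ∀ (N : ℕ) (f : Fin N → ℕ → ℂ), (∀ i, Summable fun k => ‖f i k‖) →
    (Summable fun k : Fin N → ℕ => ‖∏ i, f i (k i)‖) ∧
      ∑' k : Fin N → ℕ, ∏ i, f i (k i) = ∏ i, ∑' k, f i k := by
  intro N
  induction N with
  | zero =>
    intro f _
    refine ⟨(hasSum_fintype _).summable, ?_⟩
    rw [tsum_fintype]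
    simp
  | succ N ih =>
    intro f hf
    obtain ⟨h1, h2⟩ := ih (fun i => f i.succ) (fun i => hf _)
    have e : ∀ p : ℕ × (Fin N → ℕ), ∏ i, f i ((Fin.consEquiv fun _ => ℕ) p i) =
        f 0 p.1 * ∏ i : Fin N, f i.succ (p.2 i) := by
      intro p
      rw [Fin.prod_univ_succ]
      simp [Fin.consEquiv]
    constructor
    · rw [← (Fin.consEquiv fun _ => ℕ).summable_iff]
      refine ((hf 0).mul_norm h1).congr ?_
      intro p
      simp only [Function.comp]
      rw [e p]
    · rw [← (Fin.consEquiv fun _ => ℕ).tsum_eq]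
      simp_rw [e]
      rw [Fin.prod_univ_succ, ← h2, tsum_mul_tsum_of_summable_norm (hf 0) h1]

/-- The one-variable coefficient `1 / (k! (x+1)_k)`. -/
def cG (x : ℂ) (k : ℕ) : ℂ := ∏ j ∈ Finset.range k, (1 / (((j : ℂ) + 1) * (x + j + 1)))

theorem cG_pred {x : ℂ} (hx : NotInt x) {k : ℕ} (hk : k ≠ 0) :
    cG x (k - 1) = (k : ℂ) * (k + x) * cG x k := by
  obtain ⟨k, rfl⟩ := Nat.exists_eq_succ_of_ne_zero hk
  have h1 : ((k : ℂ) + 1) ≠ 0 := by exact_mod_cast Nat.succ_ne_zero k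
  have h2 : (x + k + 1) ≠ 0 := by
    have := hx.add_ne (k + 1); push_cast at this; rwa [← add_assoc] at this
  have e : cG x (k + 1) = cG x k * (1 / (((k : ℂ) + 1) * (x + k + 1))) := by
    rw [cG, Finset.prod_range_succ, ← cG]
  simp only [Nat.succ_eq_add_one, Nat.add_sub_cancel]
  rw [e]
  push_cast
  field_simp
  ring

theorem cAux_eq (M : ℕ) (ν : ℕ → ℂ) (hx : ∀ i ∈ Finset.Icc 1 M, NotInt (ν i - ν (i + 1)))
    (hq : ∀ m : ℕ → ℕ, m (M + 1) = 0 → 0 < ∑ i ∈ Finset.Icc 1 (M + 1), m i →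
      qB (M + 1) m ν ≠ 0) :
    ∀ (d : ℕ) (m : ℕ → ℕ), m (M + 1) = 0 → (∀ i, m i = 0 ∨ m (i + 1) = 0) →
      ∑ i ∈ Finset.Icc 1 (M + 1), m i = d →
      cAux (M + 1) ν d m = ∏ i ∈ Finset.Icc 1 M, cG (ν i - ν (i + 1)) (m i) := by
  intro d
  induction d with
  | zero =>
    intro m _ _ hs
    rw [Finset.sum_eq_zero_iff] at hs
    rw [cAux]
    symm
    apply Finset.prod_eq_one
    intro i hi
    rw [hs i (by simp only [Finset.mem_Icc] at hi ⊢; omega)]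
    simp [cG]
  | succ d ih =>
    intro m hm hadj hs
    have hq0 := hq m hm (by omega)
    rw [cAux]
    simp only [Nat.add_sub_cancel, hm, if_true, mul_zero, add_zero]
    rw [div_eq_iff hq0]
    have hterm : ∀ i ∈ Finset.Icc 1 M,
        (if m i = 0 then 0 else cAux (M + 1) ν d (dec m i)) =
        ((m i : ℂ) * (m i + (ν i - ν (i + 1)))) *
          ∏ i ∈ Finset.Icc 1 M, cG (ν i - ν (i + 1)) (m i) := by
      intro i hi
      have hiM := Finset.mem_Icc.1 hi
      split_ifs with h0
      · simp [h0]
      · have hi' : i ∈ Finset.Icc 1 (M + 1) := by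
          rw [Finset.mem_Icc]; omega
        rw [ih (dec m i)]
        · rw [← Finset.mul_prod_erase _ _ hi, ← Finset.mul_prod_erase _ (fun i => cG (ν i - ν (i + 1)) (m i)) hi,
            ← mul_assoc]
          congr 1
          · simp only [dec, Function.update_self]
            exact cG_pred (hx i hi) h0
          · apply Finset.prod_congr rfl
            intro j hj
            rw [dec, Function.update_of_ne (Finset.ne_of_mem_erase hj)]
        · rw [dec, Function.update_of_ne (by omega), hm]
        · intro j
          have hle : ∀ j, dec m i j ≤ m j := by
            intro j
            by_cases h : j = i
            · subst h; simp [dec]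
            · rw [dec, Function.update_of_ne h]
          rcases hadj j with h | h
          · left; have := hle j; omega
          · right; have := hle (j + 1); omega
        · have e1 := Finset.add_sum_erase _ m hi'
          have e2 := Finset.add_sum_erase _ (dec m i) hi'
          have e3 : ∑ j ∈ (Finset.Icc 1 (M + 1)).erase i, dec m i j =
              ∑ j ∈ (Finset.Icc 1 (M + 1)).erase i, m j := by
            apply Finset.sum_congr rfl
            intro j hj
            rw [dec, Function.update_of_ne (Finset.ne_of_mem_erase hj)]
          have e4 : dec m i i = m i - 1 := by simp [dec]
          omega
    rw [Finset.sum_congr rfl hterm, ← Finset.sum_mul, mul_comm]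
    congr 1
    simp only [qB, Nat.add_sub_cancel, hm]
    have hz : ∑ i ∈ Finset.Icc 1 M, (m i : ℂ) * (m (i + 1) : ℂ) = 0 := by
      apply Finset.sum_eq_zero
      intro i _
      rcases hadj i with h | h <;> simp [h]
    rw [hz]
    simp only [Nat.cast_zero, mul_zero, add_zero, sub_zero, ne_eq, OfNat.ofNat_ne_zero,
      not_false_eq_true, zero_pow]
    rw [← Finset.sum_add_distrib]
    apply Finset.sum_congr rfl
    intro i _
    ring

theorem wAct_one (n : ℕ) (ν : ℕ → ℂ) : wAct n (1, fun _ => false) ν = ν := by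
  funext i
  simp only [wAct]
  split_ifs with h
  · simp_all
  · have : i - 1 + 1 = i := by omega
    simp [this]
  · rfl

theorem Regular.notInt {n : ℕ} {ν : ℕ → ℂ} (h : Regular n ν) {i j : ℕ} (hi : i ∈ Finset.Icc 1 n)
    (hj : j ∈ Finset.Icc 1 n) (hij : i ≠ j) : NotInt (ν i - ν j) := by
  rw [Finset.mem_Icc] at hi hj
  intro k hk
  set a : Fin n := ⟨i - 1, by omega⟩ with ha
  set b : Fin n := ⟨j - 1, by omega⟩ with hb
  have hab : a ≠ b := by
    simp only [ha, hb, ne_eq, Fin.mk.injEq]; omega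
  refine h.2 (1, fun _ => false) (Equiv.swap a b, fun _ => false) ?_ ?_
  · intro h
    have := congrArg (fun w => w.1 a) h
    simp at this
    exact hab this
  · intro t ht
    rw [wAct_one]
    have ht' := Finset.mem_Icc.1 ht
    simp only [wAct, ht', and_self, dite_true]
    by_cases h1 : t = i
    · subst h1
      refine ⟨k, ?_⟩
      rw [← ha, Equiv.swap_apply_left, ← hk]
      have : (b : ℕ) + 1 = j := by simp only [hb]; omega
      simp [this]
    by_cases h2 : t = j
    · subst h2
      refine ⟨-k, ?_⟩
      rw [← hb, Equiv.swap_apply_right]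
      have : (a : ℕ) + 1 = i := by simp only [ha]; omega
      push_cast
      rw [← hk]
      simp [this]
    · refine ⟨0, ?_⟩
      rw [Equiv.swap_apply_of_ne_of_ne]
      · have : t - 1 + 1 = t := by omega
        simp [this]
      · simp only [ha, ne_eq, Fin.mk.injEq]; omega
      · simp only [hb, ne_eq, Fin.mk.injEq]; omega

theorem Regular.qB_ne {M : ℕ} {ν : ℕ → ℂ} (h : Regular (M + 2) ν) (m : ℕ → ℕ)
    (hm : m (M + 1) = 0) (hs : 0 < ∑ i ∈ Finset.Icc 1 (M + 1), m i) : qB (M + 1) m ν ≠ 0 := by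
  have h1 := h.1 (1, fun _ => false) (Function.update m (M + 2) 0) (by
    refine lt_of_lt_of_le hs ?_
    rw [Finset.sum_Icc_succ_top (show 1 ≤ M + 1 + 1 by omega)]
    refine le_trans (le_of_eq ?_) (Nat.le_add_right _ _)
    apply Finset.sum_congr rfl
    intro i hi
    rw [Function.update_of_ne]
    rw [Finset.mem_Icc] at hi; omega)
  rw [wAct_one] at h1
  intro h0
  apply h1
  rw [← h0]
  have e : ∀ i ∈ Finset.Icc 1 M, Function.update m (M + 2) 0 i = m i ∧
      Function.update m (M + 2) 0 (i + 1) = m (i + 1) := by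
    intro i hi
    rw [Finset.mem_Icc] at hi
    rw [Function.update_of_ne (by omega), Function.update_of_ne (by omega)]
    exact ⟨rfl, rfl⟩
  have e' : Function.update m (M + 2) 0 (M + 1) = 0 := by
    rw [Function.update_of_ne (by omega), hm]
  simp only [qB, Nat.add_sub_cancel, show M + 2 - 1 = M + 1 from rfl]
  simp only [Finset.sum_Icc_succ_top (show 1 ≤ M + 1 by omega), e', hm, Function.update_self]
  rw [Finset.sum_congr (g := fun i => (m i : ℂ) ^ 2) rfl (fun i hi => by rw [(e i hi).1]),
    Finset.sum_congr (f := fun i => ((Function.update m (M + 2) 0 i : ℕ) : ℂ) *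
      ((Function.update m (M + 2) 0 (i + 1) : ℕ) : ℂ)) (g := fun i => (m i : ℂ) * (m (i + 1) : ℂ)) rfl
      (fun i hi => by rw [(e i hi).1, (e i hi).2]),
    Finset.sum_congr (f := fun i => (ν i - ν (i + 1)) * ((Function.update m (M + 2) 0 i : ℕ) : ℂ))
      (g := fun i => (ν i - ν (i + 1)) * (m i : ℂ)) rfl
      (fun i hi => by rw [(e i hi).1])]
  simp

theorem NotInt.Gamma_ne {x : ℂ} (hx : NotInt x) : Complex.Gamma x ≠ 0 := by
  apply Complex.Gamma_ne_zero
  intro m h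
  apply hx (-m)
  push_cast
  exact h

theorem NotInt.add_int {x : ℂ} (hx : NotInt x) (k : ℤ) : NotInt (x + k) := by
  intro j h
  apply hx (j - k)
  push_cast
  linear_combination h

theorem NotInt.neg {x : ℂ} (hx : NotInt x) : NotInt (-x) := by
  intro j h
  apply hx (-j)
  push_cast
  linear_combination -h

theorem poch_zero {x : ℂ} (hx : NotInt x) : poch (x + 1) 0 = 1 := by
  have := (hx.add_int 1).Gamma_ne
  push_cast at this
  simp [poch, this]

theorem poch_inv {a : ℂ} (ha : NotInt a) (k : ℕ) :
    (poch (-a + 1) (-(k : ℤ)))⁻¹ = ∏ j ∈ Finset.range k, (-(a + j)) := by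
  induction k with
  | zero => simp [poch_zero ha.neg]
  | succ k ih =>
    rw [Finset.prod_range_succ, ← ih]
    have h1 := (ha.neg.add_int (-k)).Gamma_ne
    have h2 := ha.neg.add_ne (-k)
    have h3 := Complex.Gamma_add_one _ h2
    have h4 := (ha.neg.add_int 1).Gamma_ne
    push_cast at h1 h2 h3 h4
    simp only [poch]
    push_cast
    rw [show -a + 1 + -((k : ℂ) + 1) = -a + -k by ring, show -a + 1 + -(k : ℂ) = -a + -k + 1 by ring,
      h3, show -(a + (k : ℂ)) = -a + -k by ring]
    field_simp

theorem gT_eq {a b : ℂ} (ha : NotInt a) (hb : NotInt b) (k : ℕ) :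
    gT a b k = cG (a + b) k / (poch (-b + 1) (-(k : ℤ)) * poch (-a + 1) (-(k : ℤ))) := by
  rw [div_eq_mul_inv, mul_inv, poch_inv ha, poch_inv hb, gT, cG, ← Finset.prod_mul_distrib,
    ← Finset.prod_mul_distrib]
  apply Finset.prod_congr rfl
  intro j _
  rw [show a + b + 1 + (j : ℂ) = a + b + j + 1 by ring]
  ring

theorem extN_succ {N : ℕ} (k : Fin N → ℕ) (i : Fin N) : extN N k (i + 1) = k i := by
  have : 1 ≤ (i : ℕ) + 1 ∧ (i : ℕ) + 1 ≤ N := by omega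
  simp [extN, this]

theorem extN_eq_zero {N : ℕ} (k : Fin N → ℕ) {i : ℕ} (h : ¬ (1 ≤ i ∧ i ≤ N)) :
    extN N k i = 0 := by
  simp [extN, h]

theorem prod_fin_eq {N : ℕ} (F : ℕ → ℂ) :
    ∏ i : Fin N, F (i + 1) = ∏ i ∈ Finset.Icc 1 N, F i := by
  rw [Fin.prod_univ_eq_prod_range (fun i => F (i + 1)), Finset.range_eq_Ico,
    Finset.prod_Ico_add' F 0 N 1]
  rfl

/-- The factors of the summand. -/
def fac (N : ℕ) (P : Finset ℕ) (ν : ℕ → ℂ) (i k : ℕ) : ℂ :=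
  if i ∉ P ∧ i + 1 ∈ P then gT (ν i - ν (N + 2)) (ν (N + 2) - ν (i + 1)) k
  else if k = 0 then 1 else 0

theorem zfact_neg {k : ℕ} (hk : k ≠ 0) : zfact (0 - (k : ℤ)) = 0 := by
  rw [zfact, if_neg (by omega)]

theorem zfact_zero : zfact 0 = 1 := by simp [zfact]

theorem summand_eq {N : ℕ} {P : Finset ℕ} {ν : ℕ → ℂ} (hreg : Regular (N + 2) ν) (m : ℕ → ℕ)
    (hm : ∀ i, ¬ (1 ≤ i ∧ i ≤ N) → m i = 0) :
    cB (N + 1) ν m /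
          ((∏ i ∈ (Finset.Icc 1 N).filter (· ∈ P),
              zfact (0 - (m i : ℤ)) *
                poch (ν i - ν (N + 2) + 1) (0 - (m (i - 1) : ℤ))) *
            (∏ i ∈ (Finset.Icc 1 N).filter (· ∉ P),
              zfact (0 - (m (i - 1) : ℤ)) *
                poch (-ν i + ν (N + 2) + 1) (0 - (m i : ℤ))) *
            (if N + 1 ∈ P then
                zfact (0 - 0) *
                  poch (ν (N + 1) - ν (N + 2) + 1) (0 - (m N : ℤ))
              else
                zfact (0 - (m N : ℤ)) *
                  poch (-ν (N + 1) + ν (N + 2) + 1) (0 - 0))) =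
      ∏ i ∈ Finset.Icc 1 N, fac N P ν i (m i) := by
  have hni : ∀ i ∈ Finset.Icc 1 (N + 1), NotInt (ν i - ν (N + 2)) := by
    intro i hi
    rw [Finset.mem_Icc] at hi
    apply hreg.notInt <;> (try simp only [Finset.mem_Icc]) <;> omega
  have hni' : ∀ i ∈ Finset.Icc 1 (N + 1), NotInt (-ν i + ν (N + 2)) := by
    intro i hi
    have := (hni i hi).neg
    rwa [neg_sub, sub_eq_neg_add] at this
  have hsub : ∀ i ∈ Finset.Icc 1 N, i ∈ Finset.Icc 1 (N + 1) ∧ i + 1 ∈ Finset.Icc 1 (N + 1) := by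
    intro i hi
    simp only [Finset.mem_Icc] at hi ⊢; omega
  by_cases hsupp : ∀ i, m i ≠ 0 → i ∉ P ∧ i + 1 ∈ P
  · have hc : cB (N + 1) ν m = ∏ i ∈ Finset.Icc 1 N, cG (ν i - ν (i + 1)) (m i) := by
      rw [cB]
      apply cAux_eq N ν _ (fun m => hreg.qB_ne m) _ m (hm _ (by omega)) _ rfl
      · intro i hi
        rw [Finset.mem_Icc] at hi
        apply hreg.notInt <;> (try simp only [Finset.mem_Icc]) <;> omega
      · intro i
        by_contra! hcon
        exact (hsupp _ hcon.2).1 (hsupp _ hcon.1).2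
    set u : ℕ → ℂ := fun i => if i ∈ P then poch (ν i - ν (N + 2) + 1) (0 - (m (i - 1) : ℤ)) else 1
      with hu
    set v : ℕ → ℂ := fun i => if i ∈ P then 1 else poch (-ν i + ν (N + 2) + 1) (0 - (m i : ℤ))
      with hv
    have e1 : ∏ i ∈ (Finset.Icc 1 N).filter (· ∈ P), zfact (0 - (m i : ℤ)) *
                poch (ν i - ν (N + 2) + 1) (0 - (m (i - 1) : ℤ)) = ∏ i ∈ Finset.Icc 1 N, u i := by
      rw [Finset.prod_filter]
      apply Finset.prod_congr rfl
      intro i hi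
      simp only [hu]
      split_ifs with h
      · have : m i = 0 := by
          by_contra h0; exact (hsupp _ h0).1 h
        rw [this]; simp [zfact_zero]
      · rfl
    have hpred : ∀ i, 1 ≤ i → i ∉ P → m (i - 1) = 0 := by
      intro i h1 h
      by_contra h0
      have := (hsupp _ h0).2
      rw [Nat.sub_add_cancel h1] at this
      exact h this
    have e2 : ∏ i ∈ (Finset.Icc 1 N).filter (· ∉ P), zfact (0 - (m (i - 1) : ℤ)) *
                poch (-ν i + ν (N + 2) + 1) (0 - (m i : ℤ)) = ∏ i ∈ Finset.Icc 1 N, v i := by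
      rw [Finset.prod_filter]
      apply Finset.prod_congr rfl
      intro i hi
      simp only [hv]
      by_cases h : i ∈ P
      · simp [h]
      · simp [h, hpred i (Finset.mem_Icc.1 hi).1 h, zfact_zero]
    have e3 : (if N + 1 ∈ P then
                zfact (0 - 0) *
                  poch (ν (N + 1) - ν (N + 2) + 1) (0 - (m N : ℤ))
              else
                zfact (0 - (m N : ℤ)) *
                  poch (-ν (N + 1) + ν (N + 2) + 1) (0 - 0)) = u (N + 1) := by
      simp only [hu]
      split_ifs with h
      · simp [zfact_zero]
      · have h5 := hpred (N + 1) (by omega) h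
        simp only [Nat.add_sub_cancel] at h5
        rw [h5]
        simp [zfact_zero, poch_zero (hni' (N + 1) (by simp))]
    have e4 : (∏ i ∈ Finset.Icc 1 N, u i) * u (N + 1) = ∏ i ∈ Finset.Icc 1 N, u (i + 1) := by
      rw [← Finset.prod_Icc_succ_top (by omega), ← prod_fin_eq, ← prod_fin_eq, Fin.prod_univ_succ]
      have : u 1 = 1 := by
        simp only [hu]
        split_ifs with h
        · rw [hm _ (by omega)]
          exact poch_zero (hni 1 (by simp))
        · rfl
      simp [this]
    rw [e1, e2, e3, hc, mul_right_comm, e4, ← Finset.prod_mul_distrib, ← Finset.prod_div_distrib]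
    apply Finset.prod_congr rfl
    intro i hi
    obtain ⟨hi1, hi2⟩ := hsub i hi
    simp only [fac]
    split_ifs with h h0
    · rw [gT_eq (hni i hi1) (by have := hni' _ hi2; rwa [← sub_eq_neg_add] at this)]
      simp only [hu, hv, h.1, h.2, if_true, if_false, Nat.add_sub_cancel, zero_sub]
      congr 2
      · ring
      · congr 1; ring
      · congr 1; ring
    · have h1 : u (i + 1) = 1 := by
        simp only [hu, Nat.add_sub_cancel, h0]
        split_ifs
        · exact poch_zero (hni _ hi2)
        · rfl
      have h2 : v i = 1 := by
        simp only [hv, h0]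
        split_ifs
        · rfl
        · exact poch_zero (hni' _ hi1)
      rw [h1, h2, h0]
      simp [cG]
    · exact absurd (hsupp i h0) h
  · push Not at hsupp
    obtain ⟨i, h0, h⟩ := hsupp
    have hi : 1 ≤ i ∧ i ≤ N := by
      by_contra hcon; exact h0 (hm i hcon)
    have hR : ∏ i ∈ Finset.Icc 1 N, fac N P ν i (m i) = 0 := by
      apply Finset.prod_eq_zero (Finset.mem_Icc.2 hi)
      rw [fac, if_neg (fun hh => h hh.1 hh.2), if_neg h0]
    rw [hR]
    by_cases hiP : i ∈ P
    · rw [Finset.prod_eq_zero (i := i) (Finset.mem_filter.2 ⟨Finset.mem_Icc.2 hi, hiP⟩)]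
      · simp
      · rw [zfact_neg h0, zero_mul]
    · have hi1 := h hiP
      by_cases hiN : i = N
      · subst hiN
        rw [if_neg hi1, zfact_neg h0]
        simp
      · rw [Finset.prod_eq_zero (s := (Finset.Icc 1 N).filter (· ∉ P)) (i := i + 1)
          (Finset.mem_filter.2 ⟨Finset.mem_Icc.2 (by omega), hi1⟩)]
        · simp
        · rw [Nat.add_sub_cancel, zfact_neg h0, zero_mul]

/-- initial value of the coefficients `b^P_l(ν)`. -/
theorem stmt9 (n : ℕ) (hn : 2 ≤ n) (ν : ℕ → ℂ) (hreg : Regular n ν)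
    (P : Finset ℕ) (hP : P ⊆ Finset.Icc 1 (n - 1)) :
    bP n P ν (fun _ => 0) =
      (∏ i ∈ (Finset.Icc 1 (n - 2)).filter (fun i => i ∉ P ∧ i + 1 ∈ P),
        Complex.Gamma (ν i - ν (i + 1) + 1) /
          (Complex.Gamma (ν i - ν n + 1) * Complex.Gamma (-ν (i + 1) + ν n + 1))) ∧
      ((Finset.Icc 1 (n - 2)).filter (fun i => i ∉ P ∧ i + 1 ∈ P) = ∅ →
        bP n P ν (fun _ => 0) = 1) := by
  obtain ⟨N, rfl⟩ : ∃ N, n = N + 2 := ⟨n - 2, by omega⟩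
  have main : bP (N + 2) P ν (fun _ => 0) =
      (∏ i ∈ (Finset.Icc 1 N).filter (fun i => i ∉ P ∧ i + 1 ∈ P),
        Complex.Gamma (ν i - ν (i + 1) + 1) /
          (Complex.Gamma (ν i - ν (N + 2) + 1) * Complex.Gamma (-ν (i + 1) + ν (N + 2) + 1))) := by
    have hloc : ∀ i : ℕ, 1 ≤ i → i ≤ N → NotInt (ν i - ν (N + 2)) ∧
        NotInt (ν (N + 2) - ν (i + 1)) ∧
        NotInt ((ν i - ν (N + 2)) + (ν (N + 2) - ν (i + 1))) := by
      intro i h1 h2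
      rw [sub_add_sub_cancel]
      refine ⟨?_, ?_, ?_⟩ <;> apply hreg.notInt <;> (try simp only [Finset.mem_Icc]) <;> omega
    have hsum : ∀ i : Fin N, Summable fun k => ‖fac N P ν (i + 1) k‖ := by
      intro i
      obtain ⟨ha, hb, hab⟩ := hloc (i + 1) (by omega) (by omega)
      by_cases h : (i : ℕ) + 1 ∉ P ∧ (i : ℕ) + 1 + 1 ∈ P
      · simp only [fac, if_pos h]
        exact gT_summable ha hb hab
      · simp only [fac, if_neg h]
        apply summable_of_ne_finset_zero (s := {0})
        intro k hk
        simp at hk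
        simp [hk]
    rw [bP, if_pos (by simp)]
    simp only [zpow_zero, one_mul, show N + 2 - 1 = N + 1 from rfl, Nat.add_sub_cancel]
    have hs : ∀ k : Fin N → ℕ, (fun i => if i = N + 1 then (0 : ℤ).toNat else extN N k i) =
        extN N k := by
      intro k
      funext i
      split_ifs with h
      · rw [extN_eq_zero k (by omega)]; rfl
      · rfl
    have hsm : ∀ k : Fin N → ℕ, _ := fun k =>
      summand_eq (P := P) hreg (extN N k) (fun i hi => extN_eq_zero k hi)
    have hstep : ∑' k : Fin N → ℕ, ∏ i ∈ Finset.Icc 1 N, fac N P ν i (extN N k i) =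
        ∏ i ∈ Finset.Icc 1 N, ∑' k, fac N P ν i k := by
      simp_rw [← prod_fin_eq, extN_succ]
      exact (tsum_pi_prod N (fun i => fac N P ν (i + 1)) hsum).2
    refine (tsum_congr (β := Fin N → ℕ)
      (g := fun k : Fin N → ℕ => ∏ i ∈ Finset.Icc 1 N, fac N P ν i (extN N k i))
      (fun k => ?_)).trans ?_
    · refine Eq.trans ?_ (hsm k)
      exact congrArg (fun z => cB (N + 1) ν z / _) (hs k)
    refine Eq.trans hstep ?_
    rw [Finset.prod_filter]
    apply Finset.prod_congr rfl
    intro i hi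
    rw [Finset.mem_Icc] at hi
    obtain ⟨ha, hb, hab⟩ := hloc i hi.1 hi.2
    split_ifs with h
    · simp only [fac, if_pos h]
      rw [gT_tsum ha hb hab, sub_add_sub_cancel, ← sub_eq_neg_add]
    · simp only [fac, if_neg h]
      rw [tsum_eq_single 0]
      · simp
      · intro k hk; simp [hk]
  refine ⟨main, fun he => ?_⟩
  rw [main, show N = N + 2 - 2 from rfl, he, Finset.prod_empty]

end SO
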